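/- Let p and q be distinct primes with N = p·q and gcd(N, (p−1)·(q−1)) = 1, and let λ = lcm(p−1, q−1). Let m < N be a natural number, r an integer coprime to N, c = (N+1)^m · r^N mod N² its Paillier ciphertext, and k a natural number. Then Paillier decryption of c^k mod N² yields (k·m) mod N; i.e. L((c^k)^λ mod N²) · λ⁻¹ ≡ k·m (mod N). -/

import Mathlib

lemma paillier_aux_binom (N : ℤ) (a : ℕ) : (N + 1) ^ a ≡ 1 + N * a [ZMOD N ^ 2] := by
  induction a with
  | zero => simp
  | succ a ih =>
    rw [pow_succ (N + 1) a]
    refine (ih.mul_right (N + 1)).trans ?_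
    refine (Int.modEq_iff_dvd.mpr ⟨-a, ?_⟩)
    push_cast
    ring

lemma paillier_aux_fermat (p n : ℕ) (hp : p.Prime) (r : ℤ) (hr : IsCoprime r (p : ℤ))
    (h : p - 1 ∣ n) : r ^ n ≡ 1 [ZMOD p] := by
  obtain ⟨t, rfl⟩ := h
  have := (Int.ModEq.pow_card_sub_one_eq_one hp hr).pow t
  rwa [one_pow, ← pow_mul] at this

/-- Homomorphic scalar multiplication of Paillier (the `ScalarMul` operation):
decrypting `c^k mod N²` yields `k·m (mod N)`. -/
theorem paillier_scalar_mul_homomorphic (p q : ℕ) (hp : p.Prime) (hq : q.Prime) (hpq : p ≠ q)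
    (N lam : ℕ) (hN : N = p * q) (hcop : Nat.Coprime N ((p - 1) * (q - 1)))
    (hlam : lam = Nat.lcm (p - 1) (q - 1))
    (m : ℕ) (hm : m < N) (r : ℤ) (hr : IsCoprime r (N : ℤ))
    (c : ℤ) (hc : c = ((N : ℤ) + 1) ^ m * r ^ N % ((N : ℤ) ^ 2))
    (k : ℕ)
    (laminv : ℤ) (hlaminv : (lam : ℤ) * laminv ≡ 1 [ZMOD (N : ℤ)]) :
    ∀ u : ℕ, (c ^ k % ((N : ℤ) ^ 2)) ^ lam % ((N : ℤ) ^ 2) = 1 + (N : ℤ) * u →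
      (u : ℤ) * laminv ≡ (k : ℤ) * (m : ℤ) [ZMOD (N : ℤ)] := by
  intro u hu
  have hN0 : (N : ℤ) ≠ 0 := by
    rw [hN]
    exact_mod_cast (Nat.mul_pos hp.pos hq.pos).ne'
  have hNc : (N : ℤ) = p * q := by rw [hN]; push_cast; rfl
  have hrp : IsCoprime r (p : ℤ) := by
    rw [hNc] at hr
    exact hr.of_mul_right_left
  have hrq : IsCoprime r (q : ℤ) := by
    rw [hNc] at hr
    exact hr.of_mul_right_right
  have h1 : r ^ lam ≡ 1 [ZMOD p] :=
    paillier_aux_fermat p lam hp r hrp (hlam ▸ Nat.dvd_lcm_left _ _)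
  have h2 : r ^ lam ≡ 1 [ZMOD q] :=
    paillier_aux_fermat q lam hq r hrq (hlam ▸ Nat.dvd_lcm_right _ _)
  have h3 : (N : ℤ) ∣ r ^ lam - 1 := by
    rw [hNc]
    refine IsCoprime.mul_dvd ?_ h1.symm.dvd h2.symm.dvd
    exact Nat.isCoprime_iff_coprime.mpr ((Nat.coprime_primes hp hq).mpr hpq)
  have h4 : (r ^ lam) ^ N ≡ 1 [ZMOD (N : ℤ) ^ 2] := by
    have h := dvd_sub_pow_of_dvd_sub h3 1
    rw [pow_one, one_pow] at h
    exact (Int.modEq_iff_dvd.mpr h).symm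
  have hc' : c ≡ ((N : ℤ) + 1) ^ m * r ^ N [ZMOD (N : ℤ) ^ 2] := by
    rw [hc]; exact Int.mod_modEq _ _
  have h5 : 1 + (N : ℤ) * u ≡ 1 + (N : ℤ) * ((m * k * lam : ℕ) : ℤ) [ZMOD (N : ℤ) ^ 2] := by
    rw [← hu]
    refine (Int.mod_modEq _ _).trans ?_
    refine ((Int.mod_modEq _ _).pow lam).trans ?_
    refine ((hc'.pow k).pow lam).trans ?_
    have e : ((((N : ℤ) + 1) ^ m * r ^ N) ^ k) ^ lam
        = ((N : ℤ) + 1) ^ (m * k * lam) * ((r ^ lam) ^ N) ^ k := by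
      simp only [mul_pow, ← pow_mul]
      congr 2
      ring
    rw [e]
    have h := (paillier_aux_binom N (m * k * lam)).mul (h4.pow k)
    rwa [one_pow, mul_one] at h
  have h6 : (u : ℤ) ≡ ((m * k * lam : ℕ) : ℤ) [ZMOD (N : ℤ)] := by
    obtain ⟨t, ht⟩ := h5.dvd
    refine Int.modEq_iff_dvd.mpr ⟨t, ?_⟩
    apply mul_left_cancel₀ hN0
    linear_combination ht
  refine (h6.mul_right laminv).trans ?_
  have h := hlaminv.mul_left ((k : ℤ) * m)
  rw [mul_one] at h
  refine Eq.trans ?_ h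
  congr 1
  push_cast
  ring
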